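/- Let c be the tent-gap function. Then for every real t ≠ 0, ∫₀¹ e^{i t c(θ)} dθ = 1/2 + 2(e^{it/4} − 1)/(it), and for every t ∈ ℝ one has |∫₀¹ e^{i t c(θ)} dθ| ≥ 3/10. (This integral equals (e^{itH}δ_n)(n) for the Schrödinger operator of the periodic graph with Floquet function c; hence a sizable mass of the initial state δ_n remains at n for all times and dispersion fails.) -/

import Mathlib

/-- The tent-gap function `c` on `[0,1]`. -/
noncomputable def cFun (θ : ℝ) : ℝ :=
  if θ ≤ 1/4 then 1/4 - θ else if θ ≤ 3/4 then 0 else θ - 3/4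

theorem continuous_cFun : Continuous cFun := by
  have h : cFun = fun θ => max (1/4 - θ) 0 + max (θ - 3/4) 0 := by
    funext θ
    unfold cFun
    split_ifs with h₁ h₂
    · rw [max_eq_left (by linarith), max_eq_right (by linarith), add_zero]
    · rw [max_eq_right (by linarith), max_eq_right (by linarith), add_zero]
    · rw [max_eq_right (by linarith), max_eq_left (by linarith), zero_add]
  rw [h]
  fun_prop

theorem integral_exp_cFun (t : ℝ) (ht : t ≠ 0) :
    (∫ θ in (0:ℝ)..1, Complex.exp (Complex.I * t * (cFun θ : ℝ)))
      = 1/2 + 2 * (Complex.exp (Complex.I * t / 4) - 1) / (Complex.I * t) := by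
  have hc : Complex.I * (t : ℂ) ≠ 0 :=
    mul_ne_zero Complex.I_ne_zero (Complex.ofReal_ne_zero.mpr ht)
  have hcont : Continuous fun θ : ℝ => Complex.exp (Complex.I * t * (cFun θ : ℝ)) := by
    have := continuous_cFun
    fun_prop
  have hbase : (∫ θ in (0:ℝ)..(1/4), Complex.exp (Complex.I * t * (θ : ℝ)))
      = (Complex.exp (Complex.I * t / 4) - 1) / (Complex.I * t) := by
    rw [integral_exp_mul_complex hc]
    simp [div_eq_mul_inv]
  have hleft : (∫ θ in (0:ℝ)..(1/4), Complex.exp (Complex.I * t * (cFun θ : ℝ)))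
      = (Complex.exp (Complex.I * t / 4) - 1) / (Complex.I * t) := by
    rw [← hbase]
    have h := intervalIntegral.integral_comp_sub_left (a := 0) (b := 1/4)
      (fun θ : ℝ => Complex.exp (Complex.I * t * (θ : ℝ))) (1/4)
    rw [sub_self, sub_zero] at h
    rw [← h]
    refine intervalIntegral.integral_congr fun θ hθ => ?_
    rw [Set.uIcc_of_le (by norm_num)] at hθ
    simp only [cFun, if_pos hθ.2]
  have hmid : (∫ θ in (1/4:ℝ)..(3/4), Complex.exp (Complex.I * t * (cFun θ : ℝ))) = 1/2 := by
    rw [intervalIntegral.integral_congr (g := fun _ => (1 : ℂ))]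
    · rw [intervalIntegral.integral_const]
      norm_num
    · intro θ hθ
      rw [Set.uIcc_of_le (by norm_num)] at hθ
      have h0 : cFun θ = 0 := by
        unfold cFun
        split_ifs with h₁ h₂
        · linarith [hθ.1]
        · rfl
        · exact absurd hθ.2 h₂
      simp [h0]
  have hright : (∫ θ in (3/4:ℝ)..1, Complex.exp (Complex.I * t * (cFun θ : ℝ)))
      = (Complex.exp (Complex.I * t / 4) - 1) / (Complex.I * t) := by
    rw [← hbase]
    have h := intervalIntegral.integral_comp_sub_right (a := 3/4) (b := 1)
      (fun θ : ℝ => Complex.exp (Complex.I * t * (θ : ℝ))) (3/4)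
    rw [sub_self, show (1:ℝ) - 3/4 = 1/4 by norm_num] at h
    rw [← h]
    refine intervalIntegral.integral_congr fun θ hθ => ?_
    rw [Set.uIcc_of_le (by norm_num)] at hθ
    have h0 : cFun θ = θ - 3/4 := by
      unfold cFun
      split_ifs with h₁ h₂
      · linarith [hθ.1]
      · linarith [hθ.1]
      · rfl
    simp only [h0]
  rw [← intervalIntegral.integral_add_adjacent_intervals
      (hcont.intervalIntegrable 0 (3/4)) (hcont.intervalIntegrable (3/4) 1),
    ← intervalIntegral.integral_add_adjacent_intervals
      (hcont.intervalIntegrable 0 (1/4)) (hcont.intervalIntegrable (1/4) (3/4)),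
    hleft, hmid, hright]
  ring

theorem neg_two_fifths_le_sinc (x : ℝ) : -(2/5) ≤ Real.sinc x := by
  wlog hx : 0 ≤ x generalizing x
  · rw [← Real.sinc_neg]
    exact this (-x) (by linarith)
  rcases hx.eq_or_lt with rfl | hpos
  · norm_num [Real.sinc_zero]
  rw [Real.sinc_of_ne_zero hpos.ne', le_div_iff₀ hpos]
  rcases le_total x Real.pi with h | h
  · linarith [Real.sin_nonneg_of_nonneg_of_le_pi hx h]
  · linarith [Real.neg_one_le_sin x, Real.pi_gt_three]

theorem re_exp_sub_one_div (t : ℝ) (ht : t ≠ 0) :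
    (1/2 + 2 * (Complex.exp (Complex.I * t / 4) - 1) / (Complex.I * t)).re
      = 1/2 + Real.sinc (t / 4) / 2 := by
  have h : Complex.exp (Complex.I * t / 4)
      = (Real.cos (t / 4) : ℂ) + (Real.sin (t / 4) : ℂ) * Complex.I := by
    rw [show Complex.I * (t : ℂ) / 4 = ((t / 4 : ℝ) : ℂ) * Complex.I by push_cast; ring,
      Complex.exp_mul_I, Complex.ofReal_cos, Complex.ofReal_sin]
  have ht' : (t : ℂ) ≠ 0 := Complex.ofReal_ne_zero.mpr ht
  have hform : 1/2 + 2 * (Complex.exp (Complex.I * t / 4) - 1) / (Complex.I * t)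
      = ((1/2 + 2 * Real.sin (t / 4) / t : ℝ) : ℂ)
        + ((2 * (1 - Real.cos (t / 4)) / t : ℝ) : ℂ) * Complex.I := by
    rw [h, mul_comm Complex.I, ← div_div, Complex.div_I]
    push_cast
    linear_combination (-2 * Complex.sin (t / 4) / t) * Complex.I_sq
  rw [hform, Complex.add_re, Complex.re_ofReal_mul, Complex.ofReal_re, Complex.I_re, mul_zero,
    add_zero, Real.sinc_of_ne_zero (by positivity)]
  field_simp
  ring

/-- For the periodic graph with Floquet function `c`, the diagonal matrix element of the
Schrödinger group equals `1/2 + 2(e^{it/4} − 1)/(it)` for `t ≠ 0` and has modulus at least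
`3/10` at all times; in particular dispersion fails. -/
theorem stmt16 :
    (∀ t : ℝ, t ≠ 0 →
      (∫ θ in (0:ℝ)..1, Complex.exp (Complex.I * t * (cFun θ : ℝ)))
        = 1/2 + 2 * (Complex.exp (Complex.I * t / 4) - 1) / (Complex.I * t)) ∧
    (∀ t : ℝ, (3 : ℝ)/10 ≤ ‖∫ θ in (0:ℝ)..1, Complex.exp (Complex.I * t * (cFun θ : ℝ))‖) := by
  refine ⟨integral_exp_cFun, fun t => ?_⟩
  rcases eq_or_ne t 0 with rfl | ht
  · norm_num
  · rw [integral_exp_cFun t ht]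
    refine le_trans ?_ (Complex.re_le_norm _)
    rw [re_exp_sub_one_div t ht]
    linarith [neg_two_fifths_le_sinc (t / 4)]
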